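/- Let h_t be a C¹ flow on the two-torus 𝕋² without critical points and without periodic orbits, and suppose it admits a closed transversal γ whose first return map R has a rotation number of constant type. Let μ be the unique h_t-invariant Borel probability measure. Then there exist constants K₁ and K₂ (depending only on the flow) such that for every C¹ observable f : 𝕋² → ℝ with ∫ f dμ = 0, every x ∈ 𝕋² and every T > 0, one has |H_{x,T}(f)| ≤ K₁ ‖f‖_{C¹} log(1+T) + K₂ ‖f‖_{C¹}. -/

import Mathlib

open MeasureTheory Set
noncomputable section

/-- The two-torus `𝕋² = ℝ²/ℤ²`. -/
abbrev T2 : Type := AddCircle (1:ℝ) × AddCircle (1:ℝ)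

/-- Projection `ℝ² → 𝕋²`. -/
def projT2 (v : ℝ × ℝ) : T2 := (↑v.1, ↑v.2)

/-- A `C¹` flow on the two-torus, encoded by a jointly `C¹` lift to ℝ². -/
structure C1FlowT2 where
  flow : ℝ → T2 → T2
  lift : ℝ → ℝ × ℝ → ℝ × ℝ
  lift_contDiff : ContDiff ℝ 1 (Function.uncurry lift)
  lift_proj : ∀ t v, projT2 (lift t v) = flow t (projT2 v)
  flow_zero : ∀ x, flow 0 x = x
  flow_add : ∀ t s x, flow (t + s) x = flow t (flow s x)

namespace C1FlowT2
/-- The generating vector field of the flow (read in the universal cover). -/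
def vf (h : C1FlowT2) (v : ℝ × ℝ) : ℝ × ℝ := deriv (fun t => h.lift t v) 0
/-- The flow has no critical points: its generating vector field never vanishes. -/
def NoCriticalPoints (h : C1FlowT2) : Prop := ∀ v, h.vf v ≠ 0
/-- The flow has no periodic orbits. -/
def NoPeriodicOrbits (h : C1FlowT2) : Prop := ∀ x T, 0 < T → h.flow T x ≠ x
end C1FlowT2

/-- A closed transversal curve of the flow: a `C¹` embedded circle, everywhere
transverse to the generating vector field, meeting every orbit. -/
structure ClosedTransversal (h : C1FlowT2) where
  γ : AddCircle (1:ℝ) → T2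
  lift : ℝ → ℝ × ℝ
  lift_contDiff : ContDiff ℝ 1 lift
  lift_proj : ∀ s : ℝ, projT2 (lift s) = γ ↑s
  inj : Function.Injective γ
  transverse : ∀ s : ℝ,
    (deriv lift s).1 * (h.vf (lift s)).2 - (deriv lift s).2 * (h.vf (lift s)).1 ≠ 0
  meets : ∀ x : T2, ∃ t : ℝ, h.flow t x ∈ Set.range γ

/-- First return time to the transversal: `u x = inf {t > 0 | h_t x ∈ γ(𝕊¹)}`. -/
def returnTime (h : C1FlowT2) (Γ : ClosedTransversal h) (x : T2) : ℝ :=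
  sInf {t : ℝ | 0 < t ∧ h.flow t x ∈ Set.range Γ.γ}

/-- `F : CircleDeg1Lift` is a lift of the first return map of the flow to the
transversal `Γ`, read in the parametrization of `Γ` by the circle. -/
def ReturnMapLift (h : C1FlowT2) (Γ : ClosedTransversal h) (F : CircleDeg1Lift) : Prop :=
  ∀ s : ℝ, Γ.γ ↑(F s) = h.flow (returnTime h Γ (Γ.γ ↑s)) (Γ.γ ↑s)

/-- A real number is of constant type if it is irrational and the partial quotients
of its continued fraction expansion are bounded. -/
def IsOfConstantType (ω : ℝ) : Prop :=
  Irrational ω ∧ ∃ B : ℝ, ∀ n : ℕ, ∀ a ∈ (GenContFract.of ω).partDens.get? n, a ≤ B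

/-- `C¹` norm of an observable on the torus. -/
def C1Norm (f : T2 → ℝ) : ℝ :=
  (⨆ v : ℝ × ℝ, |f (projT2 v)|) + ⨆ v : ℝ × ℝ, ‖fderiv ℝ (fun w => f (projT2 w)) v‖

/-- Ergodic integral `H_{x,T}(f) = ∫₀^T f(h_t x) dt`. -/
def ergInt (h : C1FlowT2) (f : T2 → ℝ) (x : T2) (T : ℝ) : ℝ :=
  ∫ t in (0:ℝ)..T, f (h.flow t x)

/-- The convergents of an irrational of constant type provide, below every `N`, a reduced
fraction whose denominator is comparable to `N`. -/
theorem IsOfConstantType.exists_denominator {α : ℝ} (h : IsOfConstantType α) :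
    ∃ M : ℝ, 0 < M ∧ ∀ N : ℕ, 0 < N → ∃ (q : ℕ) (p : ℤ), 0 < q ∧ q ≤ N ∧ (N : ℝ) ≤ M * q ∧
      IsCoprime p (q : ℤ) ∧ |(q : ℝ) * α - p| * q ≤ 1 := by
  obtain ⟨hirr, B, hB⟩ := h
  set g := GenContFract.of α with hg
  have hnt : ∀ n, ¬ g.TerminatedAt n := by
    intro n hn
    have : g.Terminates := ⟨n, hn⟩
    rw [hg, GenContFract.terminates_iff_rat] at this
    obtain ⟨q, hq⟩ := this
    exact hirr ⟨q, hq.symm⟩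
  have hs : ∀ n, ∃ (z : ℤ), g.s.get? n = some ⟨1, (z : ℝ)⟩ ∧ (z : ℝ) ≤ B := by
    intro n
    obtain ⟨gp, hgp⟩ := Option.ne_none_iff_exists'.mp (fun h0 => hnt n h0)
    obtain ⟨h1, z, hz⟩ := GenContFract.of_partNum_eq_one_and_exists_int_partDen_eq hgp
    refine ⟨z, ?_, ?_⟩
    · rw [hgp]; cases gp; simp_all
    · rw [← hz]
      exact hB n _ (GenContFract.partDen_eq_s_b hgp)
  choose b hb hbB using hs
  have hint : ∀ n, (∃ P Q : ℤ, g.nums n = P ∧ g.dens n = Q) ∧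
      ∃ P Q : ℤ, g.nums (n + 1) = P ∧ g.dens (n + 1) = Q := by
    intro n
    induction n with
    | zero =>
      refine ⟨⟨⌊α⌋, 1, ?_, ?_⟩, ⟨b 0 * ⌊α⌋ + 1, b 0, ?_, ?_⟩⟩
      · simp [g, GenContFract.of_h_eq_floor]
      · simp
      · rw [zero_add, GenContFract.first_num_eq (hb 0)]
        simp [g, GenContFract.of_h_eq_floor]
      · rw [zero_add, GenContFract.first_den_eq (hb 0)]
    | succ n ih =>
      refine ⟨ih.2, ?_⟩
      obtain ⟨⟨P, Q, hP, hQ⟩, P', Q', hP', hQ'⟩ := ih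
      refine ⟨b (n + 1) * P' + P, b (n + 1) * Q' + Q, ?_, ?_⟩
      · rw [GenContFract.nums_recurrence (hb (n + 1)) hP hP']; push_cast; ring
      · rw [GenContFract.dens_recurrence (hb (n + 1)) hQ hQ']; push_cast; ring
  choose P Q hP hQ using fun n => (hint n).1
  have hmono : ∀ n, Q n ≤ Q (n + 1) := by
    intro n
    have : g.dens n ≤ g.dens (n + 1) := GenContFract.of_den_mono
    rw [hQ, hQ] at this
    exact_mod_cast this
  have hfib : ∀ n, (Nat.fib (n + 1) : ℤ) ≤ Q n := by
    intro n
    have : ((Nat.fib (n + 1) : ℕ) : ℝ) ≤ g.dens n :=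
      GenContFract.succ_nth_fib_le_of_nth_den (Or.inr (hnt _))
    rw [hQ] at this
    exact_mod_cast this
  have hpos : ∀ n, 1 ≤ Q n := fun n => by
    have h1 := hfib n
    have : 1 ≤ Nat.fib (n + 1) := Nat.fib_pos.2 (Nat.succ_pos n)
    omega
  have hB0 : (1 : ℝ) ≤ B := by
    have h1 : g.dens 1 = b 0 := by
      rw [GenContFract.first_den_eq (hb 0)]
    have h2 := hpos 1
    have h3 : ((1 : ℤ) : ℝ) ≤ (Q 1 : ℝ) := by exact_mod_cast h2
    rw [← hQ, h1] at h3
    have := hbB 0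
    push_cast at h3
    linarith
  have hgrow : ∀ n, (Q (n + 1) : ℝ) ≤ (B + 1) * Q n := by
    intro n
    cases n with
    | zero =>
      rw [← hQ, ← hQ, zero_add, GenContFract.first_den_eq (hb 0), GenContFract.zeroth_den_eq_one]
      have := hbB 0
      simp only; linarith
    | succ n =>
      have h1 := GenContFract.dens_recurrence (hb (n + 1)) (hQ n) (hQ (n + 1))
      rw [hQ] at h1
      rw [h1]
      have h2 : (Q n : ℝ) ≤ Q (n + 1) := by exact_mod_cast hmono n
      have h3 : (0 : ℝ) ≤ Q (n + 1) := by exact_mod_cast (by linarith [hpos (n + 1)])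
      have := mul_le_mul_of_nonneg_right (hbB (n + 1)) h3
      simp only; linarith
  refine ⟨B + 1, by linarith, fun N hN => ?_⟩
  have hex : ∃ n, (N : ℤ) < Q (n + 1) := by
    refine ⟨N + 5, lt_of_lt_of_le ?_ (hfib _)⟩
    have : N + 7 ≤ Nat.fib (N + 5 + 1 + 1) := Nat.le_fib_self (by omega)
    exact_mod_cast (by omega : N < Nat.fib (N + 5 + 1 + 1))
  classical
  obtain ⟨n, hn1, hn2⟩ : ∃ n, Q n ≤ N ∧ (N : ℤ) < Q (n + 1) := by
    refine ⟨Nat.find hex, ?_, Nat.find_spec hex⟩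
    rcases Nat.eq_zero_or_pos (Nat.find hex) with h0 | h0
    · rw [h0]
      have : (Q 0 : ℝ) = 1 := by rw [← hQ]; exact GenContFract.zeroth_den_eq_one
      have : Q 0 = 1 := by exact_mod_cast this
      omega
    · have := Nat.find_min hex (Nat.sub_lt h0 one_pos)
      rw [Nat.sub_add_cancel (m := 1) h0] at this
      omega
  have hdet : P n * Q (n + 1) - Q n * P (n + 1) = (-1) ^ (n + 1) := by
    have := SimpContFract.determinant (s := SimpContFract.of α) (n := n) (hnt n)
    change g.nums n * g.dens (n + 1) - g.dens n * g.nums (n + 1) = _ at this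
    rw [hP, hQ, hP, hQ] at this
    exact_mod_cast this
  have hqn : ((Q n).toNat : ℤ) = Q n := Int.toNat_of_nonneg (by linarith [hpos n])
  have hqr : ((Q n).toNat : ℝ) = Q n := by exact_mod_cast hqn
  refine ⟨(Q n).toNat, P n, by have := hpos n; omega, by omega, ?_, ?_, ?_⟩
  · rw [hqr]
    refine le_trans ?_ (hgrow n)
    exact_mod_cast hn2.le
  · rw [hqn]
    refine ⟨(-1) ^ (n + 1) * Q (n + 1), -(-1) ^ (n + 1) * P (n + 1), ?_⟩
    have : ((-1 : ℤ) ^ (n + 1)) * (-1) ^ (n + 1) = 1 := by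
      rw [← mul_pow]; simp
    calc _ = (-1) ^ (n + 1) * (P n * Q (n + 1) - Q n * P (n + 1)) := by ring
      _ = 1 := by rw [hdet, this]
  · rw [hqr]
    have h1 := GenContFract.abs_sub_convs_le (hnt n)
    rw [← hg, GenContFract.conv_eq_num_div_den, hP, hQ, hQ] at h1
    have hq0 : (1 : ℝ) ≤ Q n := by exact_mod_cast hpos n
    have hq1 : (Q n : ℝ) ≤ Q (n + 1) := by exact_mod_cast hmono n
    have h2 : |(Q n : ℝ) * α - P n| = Q n * |α - P n / Q n| := by
      rw [← abs_of_pos (by linarith : (0 : ℝ) < Q n), ← abs_mul, abs_of_pos (by linarith : (0 : ℝ) < Q n)]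
      congr 1
      field_simp
    rw [h2]
    calc (Q n : ℝ) * |α - P n / Q n| * Q n
        ≤ Q n * (1 / (Q n * Q (n + 1))) * Q n := by gcongr
      _ = Q n / Q (n + 1) := by field_simp
      _ ≤ 1 := by rw [div_le_one (by linarith)]; exact hq1

/-- Summing a `q`-periodic function along multiples of a unit mod `q` is summing over a period. -/
theorem sum_range_mul_of_isCoprime {q : ℕ} (hq : 0 < q) {p : ℤ} (hp : IsCoprime p (q : ℤ))
    (D : ℤ → ℝ) (hD : ∀ j, D (j + q) = D j) :
    ∑ i ∈ Finset.range q, D (i * p) = ∑ j ∈ Finset.range q, D j := by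
  have hD' : ∀ (k j : ℤ), D (j + k * q) = D j := by
    intro k
    induction k with
    | zero => simp
    | succ k ih => intro j; rw [← ih j, ← hD (j + k * q)]; congr 1; ring
    | pred k ih => intro j; rw [← ih j, ← hD (j + (-k - 1) * q)]; congr 1; ring
  have hmod : ∀ j : ℤ, D j = D (j % q) := fun j => by
    conv_lhs => rw [← Int.emod_add_mul_ediv j q, mul_comm, hD']
  have hq' : (0 : ℤ) < q := by exact_mod_cast hq
  have hnn : ∀ i : ℕ, 0 ≤ (i * p) % (q : ℤ) := fun i => Int.emod_nonneg _ hq'.ne'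
  have hmaps : MapsTo (fun i : ℕ => ((i * p) % (q : ℤ)).toNat) (Finset.range q : Set ℕ)
      (Finset.range q : Set ℕ) := by
    intro i _
    have := Int.emod_lt_of_pos (i * p) hq'
    have := hnn i
    simp only [Finset.coe_range, mem_Iio]; omega
  have hinj : InjOn (fun i : ℕ => ((i * p) % (q : ℤ)).toNat) (Finset.range q : Set ℕ) := by
    intro i hi j hj hij
    simp only [Finset.coe_range, mem_Iio] at hi hj hij
    have h1 : (i * p) % (q : ℤ) = (j * p) % (q : ℤ) := by
      rw [← Int.toNat_of_nonneg (hnn i), ← Int.toNat_of_nonneg (hnn j), hij]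
    have h2 : (q : ℤ) ∣ (i - j) * p := by
      rw [sub_mul]; exact Int.dvd_of_emod_eq_zero (Int.emod_eq_emod_iff_emod_sub_eq_zero.1 h1)
    have h3 : (q : ℤ) ∣ i - j := hp.symm.dvd_of_dvd_mul_right h2
    have h4 := Int.eq_zero_of_abs_lt_dvd h3 (by rw [abs_lt]; omega)
    omega
  refine Finset.sum_nbij _ hmaps hinj (Finset.surjOn_of_injOn_of_card_le _ hmaps hinj le_rfl) ?_
  intro i _
  rw [hmod, Int.toNat_of_nonneg (hnn i)]

namespace CircleDeg1Lift

/-- Every orbit of a lift of a circle homeomorphism follows, up to arbitrarily small errors, the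
image of an orbit of the translation it is semiconjugate to. -/
theorem exists_shadow {F : CircleDeg1Liftˣ} {α : ℝ} {G : CircleDeg1Lift}
    (hG : ∀ y, G (y + α) = (F : CircleDeg1Lift) (G y)) (s : ℝ) :
    ∃ θ : ℝ, ∀ δ > 0, ∀ i : ℕ, G (θ + i * α - δ) ≤ (F : CircleDeg1Lift)^[i] s ∧
      (F : CircleDeg1Lift)^[i] s ≤ G (θ + i * α + δ) := by
  have hGi : ∀ (i : ℕ) y, G (y + i * α) = (F : CircleDeg1Lift)^[i] (G y) := by
    intro i
    induction i with
    | zero => simp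
    | succ i ih => intro y; rw [Function.iterate_succ_apply', ← ih, ← hG]; congr 1; push_cast; ring
  set S : Set ℝ := {y | G y ≤ s}
  have hne : S.Nonempty := by
    refine ⟨(0 : ℝ) + (⌊s - G 0⌋ : ℤ), ?_⟩
    have := Int.floor_le (s - G 0)
    change G _ ≤ s
    rw [map_add_int]; linarith
  have hub : ∀ y ∈ S, y ≤ (0 : ℝ) + ((⌊s - G 0⌋ + 1 : ℤ) : ℝ) := by
    intro y hy
    by_contra! hlt
    have h1 := G.monotone hlt.le
    have := Int.lt_floor_add_one (s - G 0)
    rw [map_add_int] at h1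
    push_cast at h1
    have : G y ≤ s := hy
    linarith
  refine ⟨sSup S, fun δ hδ i => ?_⟩
  have e1 : sSup S + i * α - δ = (sSup S - δ) + i * α := by ring
  have e2 : sSup S + i * α + δ = (sSup S + δ) + i * α := by ring
  have hmono := (F : CircleDeg1Lift).monotone.iterate i
  rw [e1, e2, hGi, hGi]
  constructor
  · apply hmono
    obtain ⟨y, hy, hlt⟩ := exists_lt_of_lt_csSup hne (sub_lt_self (sSup S) hδ)
    exact (G.monotone hlt.le).trans hy
  · apply hmono
    by_contra! hlt
    have : sSup S + δ ≤ sSup S := le_csSup ⟨_, hub⟩ (show sSup S + δ ∈ S from hlt.le)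
    linarith

end CircleDeg1Lift

/-- The oscillation of an `L`-Lipschitz function on `[a, b]` is at most `L * (b - a)`. -/
theorem abs_sub_le_of_mem_Icc {ψ : ℝ → ℝ} {L : ℝ} (hL : ∀ x y, |ψ x - ψ y| ≤ L * |x - y|)
    (hL0 : 0 ≤ L) {a b x y : ℝ} (hx : x ∈ Icc a b) (hy : y ∈ Icc a b) :
    |ψ x - ψ y| ≤ L * (b - a) :=
  (hL x y).trans (mul_le_mul_of_nonneg_left (abs_sub_le_iff.2
    ⟨by linarith [hx.2, hy.1], by linarith [hx.1, hy.2]⟩) hL0)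

theorem sum_range_sub_shift (B : ℤ → ℝ) (q : ℕ) (hB : ∀ j, B (j + q) = B j + 1) (a : ℕ) :
    ∑ j ∈ Finset.range q, (B (j + a) - B j) = a := by
  induction a with
  | zero => simp
  | succ a ih =>
    have h1 := Finset.sum_range_sub (fun j : ℕ => B (j + a)) q
    have h2 : B (q + a) = B a + 1 := by rw [add_comm, hB]
    push_cast at h1 ⊢
    rw [h2] at h1
    rw [← ih, ← sub_eq_iff_eq_add', ← Finset.sum_sub_distrib]
    rw [zero_add, add_sub_cancel_left] at h1
    rw [← h1]
    refine Finset.sum_congr rfl fun j _ => ?_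
    rw [show (j : ℤ) + (a + 1) = j + 1 + a by ring]
    ring

/-- Denjoy–Koksma type comparison of an orbit segment whose length is a good denominator with
equidistributed points. -/
theorem abs_birkhoffSum_sub_sum_le {F : CircleDeg1Liftˣ} {α : ℝ} {G : CircleDeg1Lift}
    {ψ : ℝ → ℝ} {L : ℝ} (hψ : ∀ x, ψ (x + 1) = ψ x) (hL0 : 0 ≤ L)
    (hL : ∀ x y, |ψ x - ψ y| ≤ L * |x - y|) {q : ℕ} {p : ℤ} (hq : 0 < q)
    (hp : IsCoprime p (q : ℤ)) (hpq : |(q : ℝ) * α - p| * q ≤ 1) {s θ : ℝ}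
    (hθ : ∀ δ > 0, ∀ i : ℕ, G (θ + i * α - δ) ≤ (F : CircleDeg1Lift)^[i] s ∧
      (F : CircleDeg1Lift)^[i] s ≤ G (θ + i * α + δ)) :
    |∑ i ∈ Finset.range q, ψ ((F : CircleDeg1Lift)^[i] s) -
      ∑ j ∈ Finset.range q, ψ (G (θ + j / q))| ≤ 4 * L := by
  have hq0 : (0 : ℝ) < q := by exact_mod_cast hq
  set B : ℤ → ℝ := fun j => G (θ + j / q) with hBdef
  have hB : ∀ j, B (j + q) = B j + 1 := by
    intro j
    simp only [hBdef]
    rw [← G.map_add_one]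
    congr 1; push_cast; field_simp; ring
  have hs1 : ∑ j ∈ Finset.range q, ψ (G (θ + j / q)) = ∑ i ∈ Finset.range q, ψ (B (i * p)) := by
    rw [sum_range_mul_of_isCoprime hq hp (fun j => ψ (B j)) (fun j => by rw [hB, hψ])]
    simp [hBdef]
  have hs2 : ∑ i ∈ Finset.range q, (B (i * p + 2) - B (i * p - 2)) = 4 := by
    rw [sum_range_mul_of_isCoprime hq hp (fun j => B (j + 2) - B (j - 2))]
    · have := sum_range_sub_shift (fun j => B (j - 2)) q
        (fun j => by rw [← hB]; congr 1; ring) 4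
      push_cast at this
      rw [← this]
      refine Finset.sum_congr rfl fun j _ => ?_
      rw [show (j : ℤ) + 4 - 2 = j + 2 by ring]
    · intro j
      rw [add_right_comm, add_sub_right_comm, hB, hB]; ring
  rw [hs1, ← Finset.sum_sub_distrib]
  refine (Finset.abs_sum_le_sum_abs _ _).trans ?_
  rw [← hs2, mul_comm, Finset.mul_sum]
  refine Finset.sum_le_sum fun i hi => ?_
  have hi' : (i : ℝ) ≤ q := by exact_mod_cast (Finset.mem_range.1 hi).le
  have herr : |i * α - i * p / q| ≤ 1 / q := by
    have : i * α - i * p / q = (i / q) * (q * α - p) := by field_simp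
    rw [this, abs_mul, abs_of_nonneg (by positivity), le_div_iff₀ hq0, mul_assoc]
    calc _ ≤ 1 * (|(q : ℝ) * α - p| * q) := by
          gcongr; rw [div_le_one hq0]; exact hi'
      _ ≤ 1 := by linarith
  obtain ⟨e1, e2⟩ := abs_le.1 herr
  have hδ : (0 : ℝ) < 1 / q := by positivity
  obtain ⟨h1, h2⟩ := hθ (1 / q) hδ i
  refine abs_sub_le_of_mem_Icc hL hL0 ⟨le_trans (G.monotone ?_) h1, h2.trans (G.monotone ?_)⟩
    ⟨G.monotone ?_, G.monotone ?_⟩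
  · push_cast; rw [sub_div, show (2 : ℝ) / q = 1 / q + 1 / q by ring]; linarith
  · push_cast; rw [add_div, show (2 : ℝ) / q = 1 / q + 1 / q by ring]; linarith
  · push_cast; rw [sub_div]; have : (0 : ℝ) < 2 / q := by positivity
    linarith
  · push_cast; rw [add_div]; have : (0 : ℝ) < 2 / q := by positivity
    linarith

theorem sum_shift_period_eq {G : CircleDeg1Lift} {ψ : ℝ → ℝ} (hψ : ∀ x, ψ (x + 1) = ψ x)
    {q : ℕ} (hq : 0 < q) (θ : ℝ) (k : ℤ) :
    ∑ j ∈ Finset.range q, ψ (G (θ + k / q + j / q)) =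
      ∑ j ∈ Finset.range q, ψ (G (θ + j / q)) := by
  have hq0 : (0 : ℝ) < q := by exact_mod_cast hq
  have step : ∀ θ : ℝ, ∑ j ∈ Finset.range q, ψ (G (θ + 1 / q + j / q)) =
      ∑ j ∈ Finset.range q, ψ (G (θ + j / q)) := by
    intro θ
    have h1 := Finset.sum_range_succ (fun j : ℕ => ψ (G (θ + j / q))) q
    have h2 := Finset.sum_range_succ' (fun j : ℕ => ψ (G (θ + j / q))) q
    have h3 : ψ (G (θ + q / q)) = ψ (G (θ + (0 : ℕ) / q)) := by
      rw [div_self hq0.ne', G.map_add_one, hψ]; simp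
    rw [h1, h3] at h2
    rw [add_right_cancel h2]
    refine Finset.sum_congr rfl fun j _ => ?_
    congr 2; push_cast; ring
  induction k with
  | zero => simp
  | succ k ih => rw [← ih, ← step (θ + (k : ℤ) / q)]; refine Finset.sum_congr rfl fun j _ => ?_
                 congr 2; push_cast; ring
  | pred k ih => rw [← ih, ← step]; refine Finset.sum_congr rfl fun j _ => ?_
                 congr 2; push_cast; ring

theorem abs_sum_shift_sub_le {G : CircleDeg1Lift} {ψ : ℝ → ℝ} {L : ℝ}
    (hψ : ∀ x, ψ (x + 1) = ψ x) (hL0 : 0 ≤ L) (hL : ∀ x y, |ψ x - ψ y| ≤ L * |x - y|)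
    {q : ℕ} (hq : 0 < q) (θ θ' : ℝ) :
    |∑ j ∈ Finset.range q, ψ (G (θ + j / q)) - ∑ j ∈ Finset.range q, ψ (G (θ' + j / q))| ≤ L := by
  have hq0 : (0 : ℝ) < q := by exact_mod_cast hq
  rw [← sum_shift_period_eq hψ hq θ ⌊(θ' - θ) * q⌋, ← Finset.sum_sub_distrib]
  set η := θ + ⌊(θ' - θ) * q⌋ / q with hη
  have h1 : η ≤ θ' := by
    have : (⌊(θ' - θ) * q⌋ : ℝ) / q ≤ θ' - θ := by
      rw [div_le_iff₀ hq0]; exact Int.floor_le _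
    linarith
  have h2 : θ' ≤ η + 1 / q := by
    have : θ' - θ ≤ (⌊(θ' - θ) * q⌋ + 1 : ℝ) / q := by
      rw [le_div_iff₀ hq0]; exact (Int.lt_floor_add_one _).le
    rw [add_div] at this
    linarith
  refine (Finset.abs_sum_le_sum_abs _ _).trans ?_
  have hs := sum_range_sub_shift (fun j => G (η + j / q)) q (fun j => by
    rw [← G.map_add_one]; congr 1; push_cast; field_simp; ring) 1
  calc _ ≤ ∑ j ∈ Finset.range q, L * (G (η + ((j + (1 : ℕ) : ℤ) : ℝ) / q) - G (η + ((j : ℤ) : ℝ) / q)) := by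
        refine Finset.sum_le_sum fun j _ => ?_
        refine abs_sub_le_of_mem_Icc hL hL0 ⟨G.monotone ?_, G.monotone ?_⟩
          ⟨G.monotone ?_, G.monotone ?_⟩
        · push_cast; linarith
        · push_cast; rw [add_div]; linarith
        · push_cast; linarith
        · push_cast; rw [add_div]; linarith
    _ = L := by rw [← Finset.mul_sum, hs]; simp

/-- Logarithmic growth of differences of Birkhoff sums over a circle homeomorphism with rotation
number of constant type, for periodic Lipschitz functions. -/
theorem exists_abs_birkhoffSum_sub_le {F : CircleDeg1Liftˣ}
    (hct : IsOfConstantType ((F : CircleDeg1Lift).translationNumber)) :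
    ∃ M : ℝ, 0 < M ∧ ∀ (ψ : ℝ → ℝ) (L : ℝ), (∀ x, ψ (x + 1) = ψ x) → 0 ≤ L →
      (∀ x y, |ψ x - ψ y| ≤ L * |x - y|) → ∀ (s s' : ℝ) (N : ℕ),
      |∑ i ∈ Finset.range N, ψ ((F : CircleDeg1Lift)^[i] s) -
        ∑ i ∈ Finset.range N, ψ ((F : CircleDeg1Lift)^[i] s')| ≤
        9 * L * (1 + M * Real.log (1 + N)) := by
  set α := (F : CircleDeg1Lift).translationNumber with hα
  obtain ⟨M, hM, hden⟩ := hct.exists_denominator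
  obtain ⟨G, hG⟩ := CircleDeg1Lift.units_semiconj_of_translationNumber_eq
    (f₁ := CircleDeg1Lift.translate (Multiplicative.ofAdd α)) (f₂ := F)
    (by rw [CircleDeg1Lift.translationNumber_translate])
  have hG' : ∀ y, G (y + α) = (F : CircleDeg1Lift) (G y) := fun y => by
    rw [← hG y, CircleDeg1Lift.translate_apply, add_comm]
  refine ⟨M, hM, fun ψ L hψ hL0 hL s s' N => ?_⟩
  suffices H : ∀ N : ℕ, 0 < N → ∀ s s', |∑ i ∈ Finset.range N, ψ ((F : CircleDeg1Lift)^[i] s) -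
        ∑ i ∈ Finset.range N, ψ ((F : CircleDeg1Lift)^[i] s')| ≤ 9 * L * (1 + M * Real.log N) by
    rcases Nat.eq_zero_or_pos N with rfl | hN
    · simp; positivity
    · refine (H N hN s s').trans ?_
      have : (0 : ℝ) < N := by exact_mod_cast hN
      gcongr
      linarith
  intro N
  induction N using Nat.strong_induction_on with
  | _ N ih =>
  intro hN s s'
  obtain ⟨q, p, hq, hqN, hNM, hcop, happ⟩ := hden N hN
  have block : |∑ i ∈ Finset.range q, ψ ((F : CircleDeg1Lift)^[i] s) -
        ∑ i ∈ Finset.range q, ψ ((F : CircleDeg1Lift)^[i] s')| ≤ 9 * L := by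
    obtain ⟨θ, hθ⟩ := CircleDeg1Lift.exists_shadow hG' s
    obtain ⟨θ', hθ'⟩ := CircleDeg1Lift.exists_shadow hG' s'
    have b1 := abs_birkhoffSum_sub_sum_le hψ hL0 hL hq hcop happ hθ
    have b2 := abs_birkhoffSum_sub_sum_le hψ hL0 hL hq hcop happ hθ'
    have b3 := abs_sum_shift_sub_le (G := G) hψ hL0 hL hq θ θ'
    rw [abs_le] at *
    constructor <;> linarith [b1.1, b1.2, b2.1, b2.2, b3.1, b3.2]
  obtain ⟨N', rfl⟩ := Nat.exists_eq_add_of_le hqN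
  have hN1 : (1 : ℝ) ≤ (q + N' : ℕ) := by exact_mod_cast hN
  rcases Nat.eq_zero_or_pos N' with rfl | hN'
  · refine block.trans ?_
    have := Real.log_nonneg hN1
    nlinarith [mul_nonneg hL0 (mul_nonneg hM.le this)]
  · have h1 := ih N' (by omega) hN' ((F : CircleDeg1Lift)^[q] s) ((F : CircleDeg1Lift)^[q] s')
    have hlog : M * Real.log N' + 1 ≤ M * Real.log (q + N' : ℕ) := by
      have hN'0 : (0 : ℝ) < N' := by exact_mod_cast hN'
      have h2 : Real.log (N' / (q + N' : ℕ)) ≤ N' / (q + N' : ℕ) - 1 :=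
        Real.log_le_sub_one_of_pos (by positivity)
      rw [Real.log_div hN'0.ne' (by positivity)] at h2
      have h3 : (N' : ℝ) / (q + N' : ℕ) - 1 = - (q / (q + N' : ℕ)) := by
        push_cast; field_simp; ring
      have h4 : 1 ≤ M * (q / (q + N' : ℕ)) := by
        rw [← mul_div_assoc, le_div_iff₀ (by positivity), one_mul]; exact hNM
      rw [h3] at h2
      nlinarith
    have e : ∀ s, ∑ i ∈ Finset.range (q + N'), ψ ((F : CircleDeg1Lift)^[i] s) =
        ∑ i ∈ Finset.range q, ψ ((F : CircleDeg1Lift)^[i] s) +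
        ∑ i ∈ Finset.range N', ψ ((F : CircleDeg1Lift)^[i] ((F : CircleDeg1Lift)^[q] s)) := by
      intro s
      rw [Finset.sum_range_add]
      congr 1
      refine Finset.sum_congr rfl fun i _ => ?_
      rw [← Function.iterate_add_apply, add_comm]
    rw [e, e, add_sub_add_comm]
    refine (abs_add_le _ _).trans ((add_le_add block h1).trans ?_)
    nlinarith [mul_le_mul_of_nonneg_left hlog hL0]

theorem isOpenQuotientMap_projT2 : IsOpenQuotientMap projT2 :=
  QuotientAddGroup.isOpenQuotientMap_mk.prodMap QuotientAddGroup.isOpenQuotientMap_mk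

theorem projT2_add (v w : ℝ × ℝ) : projT2 (v + w) = projT2 v + projT2 w := rfl

theorem projT2_sub (v w : ℝ × ℝ) : projT2 (v - w) = projT2 v - projT2 w := rfl

theorem eq_of_projT2_eq {v w : ℝ × ℝ} (h : projT2 v = projT2 w) (hvw : ‖v - w‖ < 1) : v = w := by
  have h0 : projT2 (v - w) = 0 := by rw [projT2_sub, h, sub_self]
  have key : ∀ x : ℝ, (x : AddCircle (1 : ℝ)) = 0 → ‖x‖ < 1 → x = 0 := by
    intro x hx hx1
    obtain ⟨n, hn⟩ := (AddCircle.coe_eq_zero_iff (1 : ℝ)).1 hx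
    rw [zsmul_one] at hn
    rw [← hn, Real.norm_eq_abs] at hx1
    have : |n| < 1 := by exact_mod_cast hx1
    rw [← hn, Int.abs_lt_one_iff.1 this, Int.cast_zero]
  have h1 := key _ (congrArg Prod.fst h0) ((norm_fst_le _).trans_lt hvw)
  have h2 := key _ (congrArg Prod.snd h0) ((norm_snd_le _).trans_lt hvw)
  exact sub_eq_zero.1 (Prod.ext h1 h2)

namespace C1FlowT2

theorem continuous_flow (h : C1FlowT2) : Continuous fun z : ℝ × T2 => h.flow z.1 z.2 := by
  rw [← (IsOpenQuotientMap.id.prodMap isOpenQuotientMap_projT2).isQuotientMap.continuous_iff.symm]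
  have : (fun z : ℝ × T2 => h.flow z.1 z.2) ∘ Prod.map id projT2 =
      projT2 ∘ Function.uncurry h.lift := by
    ext1 z; exact (h.lift_proj _ _).symm
  rw [this]
  exact isOpenQuotientMap_projT2.continuous.comp h.lift_contDiff.continuous

theorem flow_neg_flow (h : C1FlowT2) (t : ℝ) (x : T2) : h.flow (-t) (h.flow t x) = x := by
  rw [← h.flow_add, neg_add_cancel, h.flow_zero]

theorem NoPeriodicOrbits.flow_injective {h : C1FlowT2} (hper : h.NoPeriodicOrbits) {x : T2}
    {a b : ℝ} (hab : h.flow a x = h.flow b x) : a = b := by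
  have key : ∀ a b, a < b → h.flow a x ≠ h.flow b x := by
    intro a b hlt heq
    refine hper (h.flow a x) (b - a) (sub_pos.2 hlt) ?_
    rw [← h.flow_add, sub_add_cancel, heq]
  rcases lt_trichotomy a b with hlt | heq | hlt
  · exact (key _ _ hlt hab).elim
  · exact heq
  · exact (key _ _ hlt hab.symm).elim

theorem eventually_lift_zero (h : C1FlowT2) (v : ℝ × ℝ) :
    ∀ᶠ w in nhds v, h.lift 0 w = w + (h.lift 0 v - v) := by
  have hc : Continuous fun w => h.lift 0 w :=
    h.lift_contDiff.continuous.comp (Continuous.prodMk_right 0)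
  have ht : Filter.Tendsto (fun w => ‖h.lift 0 w - (w + (h.lift 0 v - v))‖) (nhds v) (nhds 0) := by
    have : Continuous fun w => ‖h.lift 0 w - (w + (h.lift 0 v - v))‖ := by fun_prop
    have h2 := this.tendsto v
    simpa using h2
  filter_upwards [ht.eventually (gt_mem_nhds one_pos)] with w hw
  refine eq_of_projT2_eq ?_ hw
  rw [projT2_add, projT2_sub, h.lift_proj, h.lift_proj, h.flow_zero, h.flow_zero, sub_self,
    add_zero]

end C1FlowT2

namespace ClosedTransversal

/-- Flowing the lift of the transversal, in the coordinates (time, parameter). -/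
def chart {h : C1FlowT2} (Γ : ClosedTransversal h) (z : ℝ × ℝ) : ℝ × ℝ := h.lift z.1 (Γ.lift z.2)

variable {h : C1FlowT2} (Γ : ClosedTransversal h)

theorem contDiff_chart : ContDiff ℝ 1 Γ.chart :=
  h.lift_contDiff.comp (contDiff_fst.prodMk (Γ.lift_contDiff.comp contDiff_snd))

theorem projT2_chart (z : ℝ × ℝ) : projT2 (Γ.chart z) = h.flow z.1 (Γ.γ z.2) := by
  rw [chart, h.lift_proj, Γ.lift_proj]

theorem continuous_γ : Continuous Γ.γ := by
  rw [← (QuotientAddGroup.isOpenQuotientMap_mk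
    (N := AddSubgroup.zmultiples (1 : ℝ))).isQuotientMap.continuous_iff.symm]
  have : Γ.γ ∘ (QuotientAddGroup.mk : ℝ → AddCircle (1 : ℝ)) = projT2 ∘ Γ.lift := by
    ext1 s; exact (Γ.lift_proj s).symm
  rw [this]
  exact isOpenQuotientMap_projT2.continuous.comp Γ.lift_contDiff.continuous

theorem exists_hasFDerivAt_chart (r : ℝ) :
    ∃ e : (ℝ × ℝ) ≃L[ℝ] (ℝ × ℝ), HasFDerivAt Γ.chart (e : ℝ × ℝ →L[ℝ] ℝ × ℝ) (0, r) := by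
  have hd : HasFDerivAt Γ.chart (fderiv ℝ Γ.chart (0, r)) (0, r) :=
    (Γ.contDiff_chart.differentiable one_ne_zero _).hasFDerivAt
  set A := fderiv ℝ Γ.chart (0, r)
  have h1 : A (1, 0) = h.vf (Γ.lift r) := by
    have hc : HasDerivAt (fun t : ℝ => ((t, r) : ℝ × ℝ)) (1, 0) 0 :=
      (hasDerivAt_id 0).prodMk (hasDerivAt_const 0 r)
    exact (hd.comp_hasDerivAt (0 : ℝ) hc).deriv.symm
  have h2 : A (0, 1) = deriv Γ.lift r := by
    have hc : HasDerivAt (fun s : ℝ => ((0, s) : ℝ × ℝ)) (0, 1) r :=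
      (hasDerivAt_const r 0).prodMk (hasDerivAt_id r)
    have h3 := hd.comp_hasDerivAt r hc
    have h4 : Γ.chart ∘ (fun s : ℝ => ((0, s) : ℝ × ℝ)) =ᶠ[nhds r]
        fun s => Γ.lift s + (h.lift 0 (Γ.lift r) - Γ.lift r) :=
      Γ.lift_contDiff.continuous.continuousAt.eventually (h.eventually_lift_zero (Γ.lift r))
    have h5 := ((Γ.lift_contDiff.differentiable one_ne_zero r).hasDerivAt.add_const
      (h.lift 0 (Γ.lift r) - Γ.lift r)).congr_of_eventuallyEq h4
    exact h3.unique h5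
  have hA : ∀ z : ℝ × ℝ, A z = z.1 • h.vf (Γ.lift r) + z.2 • deriv Γ.lift r := by
    intro z
    rw [← h1, ← h2, ← map_smul, ← map_smul, ← map_add]
    congr 1
    ext <;> simp
  have htr := Γ.transverse r
  have hinj : Function.Injective (A : ℝ × ℝ →ₗ[ℝ] ℝ × ℝ) := by
    rw [injective_iff_map_eq_zero]
    intro z hz
    have hz' : A z = 0 := hz
    rw [hA] at hz'
    have e1 := congrArg Prod.fst hz'
    have e2 := congrArg Prod.snd hz'
    simp only [Prod.fst_add, Prod.snd_add, Prod.smul_fst, Prod.smul_snd, smul_eq_mul,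
      Prod.fst_zero, Prod.snd_zero] at e1 e2
    refine Prod.ext ?_ ?_
    · refine (mul_eq_zero.1 (?_ : z.1 * _ = 0)).resolve_right htr
      linear_combination (deriv Γ.lift r).1 * e2 - (deriv Γ.lift r).2 * e1
    · refine (mul_eq_zero.1 (?_ : z.2 * _ = 0)).resolve_right htr
      linear_combination (h.vf (Γ.lift r)).2 * e1 - (h.vf (Γ.lift r)).1 * e2
  refine ⟨(LinearEquiv.ofInjectiveEndo (A : ℝ × ℝ →ₗ[ℝ] ℝ × ℝ) hinj).toContinuousLinearEquiv, ?_⟩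
  have hAe : ((LinearEquiv.ofInjectiveEndo (A : ℝ × ℝ →ₗ[ℝ] ℝ × ℝ) hinj).toContinuousLinearEquiv :
      ℝ × ℝ →L[ℝ] ℝ × ℝ) = A := ContinuousLinearMap.ext fun z => rfl
  rwa [hAe]

theorem exists_chart_inverse (r : ℝ) :
    ∃ Θ : ℝ × ℝ → ℝ × ℝ, ContDiffAt ℝ 1 Θ (Γ.chart (0, r)) ∧ Θ (Γ.chart (0, r)) = (0, r) ∧
      (∀ᶠ z in nhds (0, r), Θ (Γ.chart z) = z) ∧
      ∀ᶠ w in nhds (Γ.chart (0, r)), Γ.chart (Θ w) = w := by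
  obtain ⟨e, he⟩ := Γ.exists_hasFDerivAt_chart r
  have hc : ContDiffAt ℝ 1 Γ.chart (0, r) := Γ.contDiff_chart.contDiffAt
  exact ⟨hc.localInverse he one_ne_zero, hc.to_localInverse he one_ne_zero,
    hc.localInverse_apply_image he one_ne_zero,
    (hc.hasStrictFDerivAt' he one_ne_zero).eventually_left_inverse,
    (hc.hasStrictFDerivAt' he one_ne_zero).eventually_right_inverse⟩

end ClosedTransversal

section ReturnTime

variable {h : C1FlowT2} {Γ : ClosedTransversal h} {F : CircleDeg1Liftˣ}

theorem continuous_units (F : CircleDeg1Liftˣ) : Continuous (F : CircleDeg1Lift) := by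
  rw [← CircleDeg1Lift.coe_toOrderIso]
  exact (CircleDeg1Lift.toOrderIso F).continuous

theorem returnTime_nonneg (x : T2) : 0 ≤ returnTime h Γ x :=
  Real.sInf_nonneg fun _ ht => ht.1.le

theorem returnTime_le {x : T2} {t : ℝ} (ht : 0 < t) (hx : h.flow t x ∈ Set.range Γ.γ) :
    returnTime h Γ x ≤ t :=
  csInf_le ⟨0, fun _ hs => hs.1.le⟩ ⟨ht, hx⟩

theorem returnTime_pos (hF : ReturnMapLift h Γ (F : CircleDeg1Lift))
    (hirr : Irrational ((F : CircleDeg1Lift).translationNumber)) (s : ℝ) :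
    0 < returnTime h Γ (Γ.γ s) := by
  refine lt_of_le_of_ne (returnTime_nonneg _) fun h0 => ?_
  have h1 := hF s
  rw [← h0, h.flow_zero] at h1
  have h2 : ((((F : CircleDeg1Lift) s - s : ℝ)) : AddCircle (1 : ℝ)) = 0 := by
    rw [AddCircle.coe_sub, Γ.inj h1, sub_self]
  obtain ⟨n, hn⟩ := (AddCircle.coe_eq_zero_iff (1 : ℝ)).1 h2
  rw [zsmul_one] at hn
  exact hirr.ne_int n ((F : CircleDeg1Lift).translationNumber_of_eq_add_int (by rw [hn]; ring))

theorem contDiff_returnTime (hper : h.NoPeriodicOrbits)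
    (hF : ReturnMapLift h Γ (F : CircleDeg1Lift))
    (hirr : Irrational ((F : CircleDeg1Lift).translationNumber)) :
    ContDiff ℝ 1 fun s : ℝ => returnTime h Γ (Γ.γ s) := by
  rw [contDiff_iff_contDiffAt]
  intro s₀
  set u : ℝ → ℝ := fun s => returnTime h Γ (Γ.γ s) with hu
  set t₀ := u s₀ with ht₀
  set r₀ := (F : CircleDeg1Lift) s₀ with hr₀
  have ht₀pos : 0 < t₀ := returnTime_pos hF hirr s₀
  obtain ⟨Θ, hΘd, hΘ0, hΘl, hΘr⟩ := Γ.exists_chart_inverse r₀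
  set m := Γ.chart (0, r₀) - Γ.chart (t₀, s₀) with hm
  have hm0 : projT2 m = 0 := by
    rw [hm, projT2_sub, Γ.projT2_chart, Γ.projT2_chart, h.flow_zero, sub_eq_zero]
    exact hF s₀
  set p : ℝ → ℝ × ℝ := fun s => Γ.chart (t₀, s) + m with hp
  have hpd : ContDiff ℝ 1 p :=
    (Γ.contDiff_chart.comp (contDiff_const.prodMk contDiff_id)).add contDiff_const
  have hp0 : p s₀ = Γ.chart (0, r₀) := by simp [hp, hm]
  have hpproj : ∀ s, projT2 (p s) = h.flow t₀ (Γ.γ s) := fun s => by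
    rw [hp]; simp only; rw [projT2_add, hm0, add_zero, Γ.projT2_chart]
  have hpt : Filter.Tendsto p (nhds s₀) (nhds (Γ.chart (0, r₀))) := by
    rw [← hp0]; exact hpd.continuous.tendsto s₀
  have hΘp : ContDiffAt ℝ 1 (fun s => Θ (p s)) s₀ := by
    refine ContDiffAt.comp s₀ (g := Θ) ?_ hpd.contDiffAt
    rw [hp0]; exact hΘd
  have hτ : Filter.Tendsto (fun s => (Θ (p s)).1) (nhds s₀) (nhds 0) := by
    have := (continuous_fst.continuousAt.comp hΘp.continuousAt).tendsto
    simpa [hp0, hΘ0, Function.comp_def] using this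
  have hbdd : ∀ᶠ s in nhds s₀, u s ∈ Icc 0 (t₀ + 1) := by
    filter_upwards [hpt.eventually hΘr, hτ.eventually (Ioo_mem_nhds neg_one_lt_zero ht₀pos)]
      with s hs1 hs2
    refine ⟨returnTime_nonneg _, (returnTime_le (t := t₀ - (Θ (p s)).1)
      (by linarith [hs2.2]) ⟨((Θ (p s)).2 : ℝ), ?_⟩).trans (by linarith [hs2.1])⟩
    have h1 : h.flow (Θ (p s)).1 (Γ.γ (Θ (p s)).2) = h.flow t₀ (Γ.γ s) := by
      rw [← Γ.projT2_chart, hs1, hpproj]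
    rw [sub_eq_neg_add, h.flow_add, ← h1, h.flow_neg_flow]
  have hFc := continuous_units F
  have hγs : Continuous fun s : ℝ => Γ.γ s := Γ.continuous_γ.comp (AddCircle.continuous_mk' 1)
  have hut : Filter.Tendsto u (nhds s₀) (nhds t₀) := by
    refine isCompact_Icc.tendsto_nhds_of_unique_mapClusterPt hbdd fun a ha hcl => ?_
    obtain ⟨U, hU, hUa⟩ := mapClusterPt_iff_ultrafilter.1 hcl
    have l1 : Filter.Tendsto (fun s : ℝ => h.flow (u s) (Γ.γ s)) U
        (nhds (h.flow a (Γ.γ s₀))) :=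
      (h.continuous_flow.tendsto (a, Γ.γ s₀)).comp
        (hUa.prodMk_nhds ((hγs.tendsto s₀).mono_left hU))
    have l2 : Filter.Tendsto (fun s : ℝ => h.flow (u s) (Γ.γ s)) U
        (nhds (Γ.γ ((F : CircleDeg1Lift) s₀))) := by
      simp only [hu, ← hF _]
      exact ((hγs.comp hFc).tendsto s₀).mono_left hU
    refine hper.flow_injective (x := Γ.γ s₀) ?_
    rw [tendsto_nhds_unique l1 l2, hF s₀]
  have hpair : Filter.Tendsto (fun s => ((t₀ - u s, (F : CircleDeg1Lift) s) : ℝ × ℝ)) (nhds s₀)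
      (nhds (0, r₀)) := by
    refine Filter.Tendsto.prodMk_nhds ?_ (hFc.tendsto s₀)
    simpa using hut.const_sub t₀
  have hclose : ∀ᶠ s in nhds s₀, ‖Γ.chart (t₀ - u s, (F : CircleDeg1Lift) s) - p s‖ < 1 := by
    have := (((Γ.contDiff_chart.continuous.tendsto _).comp hpair).sub hpt).norm
    rw [sub_self, norm_zero] at this
    exact this.eventually (gt_mem_nhds one_pos)
  have hform : (fun s => t₀ - (Θ (p s)).1) =ᶠ[nhds s₀] u := by
    filter_upwards [hclose, hpair.eventually hΘl] with s hs1 hs2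
    have heq : Γ.chart (t₀ - u s, (F : CircleDeg1Lift) s) = p s := by
      refine eq_of_projT2_eq ?_ hs1
      rw [Γ.projT2_chart, hpproj, hF s, ← h.flow_add, sub_add_cancel]
    rw [← heq, hs2]; ring
  exact (contDiffAt_const.sub (contDiff_fst.contDiffAt.comp s₀ hΘp)).congr_of_eventuallyEq hform.symm

end ReturnTime

section Observable

variable {f : T2 → ℝ}

theorem continuous_of_contDiff_projT2 (hf : ContDiff ℝ 1 fun v => f (projT2 v)) :
    Continuous f := by
  rw [isOpenQuotientMap_projT2.isQuotientMap.continuous_iff]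
  exact hf.continuous

theorem bddAbove_range_abs (hf : ContDiff ℝ 1 fun v => f (projT2 v)) :
    BddAbove (Set.range fun v : ℝ × ℝ => |f (projT2 v)|) := by
  obtain ⟨C, hC⟩ := isCompact_univ.exists_bound_of_continuousOn
    (continuous_of_contDiff_projT2 hf).continuousOn
  exact ⟨C, by rintro _ ⟨v, rfl⟩; exact hC _ (mem_univ _)⟩

theorem exists_int_translate (v : ℝ × ℝ) :
    ∃ m : ℝ × ℝ, projT2 m = 0 ∧ v + m ∈ Icc (0 : ℝ × ℝ) 1 := by
  have key : ∀ a : ℝ, ((-⌊a⌋ : ℝ) : AddCircle (1 : ℝ)) = 0 := fun a =>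
    (AddCircle.coe_eq_zero_iff (1 : ℝ)).2 ⟨-⌊a⌋, by rw [zsmul_one, Int.cast_neg]⟩
  refine ⟨(-⌊v.1⌋, -⌊v.2⌋), Prod.ext (key v.1) (key v.2), ?_⟩
  · refine ⟨⟨?_, ?_⟩, ⟨?_, ?_⟩⟩ <;>
      simp only [Prod.fst_add, Prod.snd_add, Prod.fst_zero, Prod.snd_zero, Prod.fst_one,
        Prod.snd_one]
    · linarith [Int.floor_le v.1]
    · linarith [Int.floor_le v.2]
    · linarith [Int.lt_floor_add_one v.1]
    · linarith [Int.lt_floor_add_one v.2]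

theorem bddAbove_range_norm_fderiv (hf : ContDiff ℝ 1 fun v => f (projT2 v)) :
    BddAbove (Set.range fun v : ℝ × ℝ => ‖fderiv ℝ (fun w => f (projT2 w)) v‖) := by
  obtain ⟨C, hC⟩ := (isCompact_Icc (a := (0 : ℝ × ℝ)) (b := 1)).exists_bound_of_continuousOn
    (hf.continuous_fderiv one_ne_zero).continuousOn
  refine ⟨C, ?_⟩
  rintro _ ⟨v, rfl⟩
  obtain ⟨m, hm0, hm⟩ := exists_int_translate v
  have h1 := fderiv_comp_add_right (𝕜 := ℝ) (f := fun w => f (projT2 w)) (x := v) m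
  simp only [projT2_add, hm0, add_zero] at h1
  simp only [h1]
  exact hC _ hm

theorem C1Norm_nonneg : 0 ≤ C1Norm f :=
  add_nonneg (Real.iSup_nonneg fun _ => abs_nonneg _) (Real.iSup_nonneg fun _ => norm_nonneg _)

theorem abs_le_C1Norm (hf : ContDiff ℝ 1 fun v => f (projT2 v)) (x : T2) : |f x| ≤ C1Norm f := by
  obtain ⟨v, rfl⟩ := isOpenQuotientMap_projT2.surjective x
  exact (le_ciSup (bddAbove_range_abs hf) v).trans
    (le_add_of_nonneg_right (Real.iSup_nonneg fun _ => norm_nonneg _))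

theorem abs_sub_le_C1Norm (hf : ContDiff ℝ 1 fun v => f (projT2 v)) (v w : ℝ × ℝ) :
    |f (projT2 v) - f (projT2 w)| ≤ C1Norm f * ‖v - w‖ := by
  refine Convex.norm_image_sub_le_of_norm_fderiv_le (𝕜 := ℝ) (f := fun w => f (projT2 w))
    (fun x _ => hf.differentiable one_ne_zero x) (fun x _ => ?_) convex_univ (mem_univ w)
    (mem_univ v)
  exact (le_ciSup (bddAbove_range_norm_fderiv hf) x).trans
    (le_add_of_nonneg_left (Real.iSup_nonneg fun _ => abs_nonneg _))

theorem C1Norm_one : C1Norm (fun _ => 1) = 1 := by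
  simp [C1Norm]

variable {h : C1FlowT2}

theorem continuous_orbit (h : C1FlowT2) (x : T2) : Continuous fun t => h.flow t x :=
  h.continuous_flow.comp (Continuous.prodMk_left x)

theorem ergInt_add (hf : Continuous f) (x : T2) (a b : ℝ) :
    ergInt h f x (a + b) = ergInt h f x a + ergInt h f (h.flow a x) b := by
  have hc : Continuous fun t => f (h.flow t x) := hf.comp (continuous_orbit h x)
  unfold ergInt
  rw [← intervalIntegral.integral_add_adjacent_intervals (hc.intervalIntegrable 0 a)
    (hc.intervalIntegrable a (a + b))]
  congr 1
  simp only [← h.flow_add]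
  rw [intervalIntegral.integral_comp_add_right (fun t => f (h.flow t x)), zero_add, add_comm b]

theorem abs_ergInt_le (hf : ContDiff ℝ 1 fun v => f (projT2 v)) (x : T2) (T : ℝ) :
    |ergInt h f x T| ≤ C1Norm f * |T| := by
  have := intervalIntegral.norm_integral_le_of_norm_le_const (a := 0) (b := T)
    (f := fun t => f (h.flow t x)) (C := C1Norm f) (fun t _ => abs_le_C1Norm hf _)
  simpa [ergInt] using this

theorem ergInt_one (x : T2) (T : ℝ) : ergInt h (fun _ => 1) x T = T := by
  simp [ergInt]

theorem abs_ergInt_flow_sub_le (hf : ContDiff ℝ 1 fun v => f (projT2 v)) (x : T2) (a T : ℝ) :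
    |ergInt h f (h.flow a x) T - ergInt h f x T| ≤ 2 * (C1Norm f * |a|) := by
  have hc := continuous_of_contDiff_projT2 hf
  have h1 := ergInt_add (h := h) hc x a T
  have h2 := ergInt_add (h := h) hc x T a
  rw [add_comm T a] at h2
  have h3 := abs_ergInt_le (h := h) hf x a
  have h4 := abs_ergInt_le (h := h) hf (h.flow T x) a
  rw [abs_le] at *
  constructor <;> linarith [h3.1, h3.2, h4.1, h4.2]

end Observable

theorem lipschitz_of_periodic {ψ : ℝ → ℝ} {L : ℝ} (hL0 : 0 ≤ L) (hψ : ∀ x, ψ (x + 1) = ψ x)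
    (hL : ∀ x ∈ Icc (0 : ℝ) 2, ∀ y ∈ Icc (0 : ℝ) 2, |ψ x - ψ y| ≤ L * |x - y|) (x y : ℝ) :
    |ψ x - ψ y| ≤ L * |x - y| := by
  have hper : Function.Periodic ψ 1 := hψ
  have hi : ∀ (x : ℝ) (n : ℤ), ψ (x - n) = ψ x := fun x n => by
    have := hper.sub_int_mul_eq (x := x) n
    simpa using this
  have key : ∀ x y, x ≤ y → |ψ x - ψ y| ≤ L * |x - y| := by
    intro x y hxy
    rw [← hi x ⌊x⌋, ← hi y ⌊x⌋]
    have hx1 := Int.floor_le x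
    have hx2 := Int.lt_floor_add_one x
    rcases le_total (y - ⌊x⌋) 2 with h2 | h2
    · refine (hL _ ⟨by linarith, by linarith⟩ _ ⟨by linarith, h2⟩).trans_eq ?_
      congr 2; ring
    · rw [← hi (y - ⌊x⌋) ⌊y - ⌊x⌋⌋]
      set z := y - ⌊x⌋
      have hz1 := Int.floor_le z
      have hz2 := Int.lt_floor_add_one z
      refine (hL _ ⟨by linarith, by linarith⟩ _ ⟨by linarith, by linarith⟩).trans ?_
      refine mul_le_mul_of_nonneg_left ?_ hL0
      rw [abs_sub_comm x y, abs_of_nonneg (sub_nonneg.2 hxy), abs_le]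
      constructor <;> linarith
  rcases le_total x y with hxy | hxy
  · exact key x y hxy
  · rw [abs_sub_comm, abs_sub_comm x y]; exact key y x hxy

section Assembly

variable {h : C1FlowT2} {Γ : ClosedTransversal h} {F : CircleDeg1Liftˣ}

theorem returnTime_add_one (s : ℝ) :
    returnTime h Γ (Γ.γ ((s + 1 : ℝ) : AddCircle (1 : ℝ))) = returnTime h Γ (Γ.γ s) := by
  rw [AddCircle.coe_add, AddCircle.coe_period, add_zero]

theorem exists_returnTime_bounds (hper : h.NoPeriodicOrbits)
    (hF : ReturnMapLift h Γ (F : CircleDeg1Lift))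
    (hirr : Irrational ((F : CircleDeg1Lift).translationNumber)) :
    ∃ ε U : ℝ, 0 < ε ∧ ∀ s : ℝ, returnTime h Γ (Γ.γ s) ∈ Icc ε U := by
  have hc := (contDiff_returnTime hper hF hirr).continuous
  obtain ⟨a, -, ha⟩ := isCompact_Icc.exists_isMinOn (nonempty_Icc.2 (zero_le_one (α := ℝ)))
    hc.continuousOn
  obtain ⟨b, -, hb⟩ := isCompact_Icc.exists_isMaxOn (nonempty_Icc.2 (zero_le_one (α := ℝ)))
    hc.continuousOn
  refine ⟨_, returnTime h Γ (Γ.γ b), returnTime_pos hF hirr a, fun s => ?_⟩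
  have hfr : ((s : ℝ) : AddCircle (1 : ℝ)) = (Int.fract s : ℝ) := by
    rw [eq_comm, ← sub_eq_zero, ← AddCircle.coe_sub, AddCircle.coe_eq_zero_iff]
    exact ⟨-⌊s⌋, by rw [zsmul_one, Int.fract]; push_cast; ring⟩
  have hmem : Int.fract s ∈ Icc (0 : ℝ) 1 := ⟨Int.fract_nonneg s, (Int.fract_lt_one s).le⟩
  rw [hfr]
  exact ⟨ha hmem, hb hmem⟩

theorem exists_lipschitz_ergInt (hper : h.NoPeriodicOrbits)
    (hF : ReturnMapLift h Γ (F : CircleDeg1Lift))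
    (hirr : Irrational ((F : CircleDeg1Lift).translationNumber)) :
    ∃ L : ℝ, 0 ≤ L ∧ ∀ f : T2 → ℝ, ContDiff ℝ 1 (fun v => f (projT2 v)) → ∀ s s' : ℝ,
      |ergInt h f (Γ.γ s) (returnTime h Γ (Γ.γ s)) -
        ergInt h f (Γ.γ s') (returnTime h Γ (Γ.γ s'))| ≤ L * C1Norm f * |s - s'| := by
  obtain ⟨ε, U, hε, hU⟩ := exists_returnTime_bounds hper hF hirr
  have hU0 : 0 ≤ U := hε.le.trans ((hU 0).1.trans (hU 0).2)
  obtain ⟨Ku, hKu⟩ := (contDiff_returnTime hper hF hirr).contDiffOn.exists_lipschitzOnWith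
    one_ne_zero (convex_Icc (0 : ℝ) 2) isCompact_Icc
  obtain ⟨Kc, hKc⟩ := Γ.contDiff_chart.contDiffOn.exists_lipschitzOnWith
    one_ne_zero (convex_Icc ((0, 0) : ℝ × ℝ) (U, 2)) isCompact_Icc
  refine ⟨Ku + Kc * U, by positivity, fun f hf => ?_⟩
  have hA := C1Norm_nonneg (f := f)
  refine lipschitz_of_periodic (by positivity) (fun s => by
    rw [returnTime_add_one, AddCircle.coe_add, AddCircle.coe_period, add_zero]) ?_
  intro s hs s' hs'
  have hc : ∀ x, Continuous fun t => f (h.flow t x) := fun x =>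
    (continuous_of_contDiff_projT2 hf).comp (continuous_orbit h x)
  set u := returnTime h Γ (Γ.γ s)
  set u' := returnTime h Γ (Γ.γ s') with hu'
  have hu : |u - u'| ≤ Ku * |s - s'| := by
    have := hKu.dist_le_mul s hs s' hs'
    simpa [Real.dist_eq] using this
  have h1 : |ergInt h f (Γ.γ s) u - ergInt h f (Γ.γ s) u'| ≤ C1Norm f * (Ku * |s - s'|) := by
    have := ergInt_add (h := h) (continuous_of_contDiff_projT2 hf) (Γ.γ s) u' (u - u')
    rw [add_sub_cancel] at this
    rw [this, add_sub_cancel_left]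
    exact (abs_ergInt_le hf _ _).trans (mul_le_mul_of_nonneg_left hu hA)
  have h2 : |ergInt h f (Γ.γ s) u' - ergInt h f (Γ.γ s') u'| ≤
      C1Norm f * (Kc * |s - s'|) * U := by
    have hb := hU s'
    rw [← hu'] at hb
    have hu'0 : 0 ≤ u' := returnTime_nonneg _
    unfold ergInt
    rw [← intervalIntegral.integral_sub ((hc _).intervalIntegrable _ _)
      ((hc _).intervalIntegrable _ _)]
    have := intervalIntegral.norm_integral_le_of_norm_le_const (a := 0) (b := u')
      (f := fun t => f (h.flow t (Γ.γ s)) - f (h.flow t (Γ.γ s')))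
      (C := C1Norm f * (Kc * |s - s'|)) (fun t ht => ?_)
    · refine this.trans ?_
      rw [sub_zero, abs_of_nonneg hu'0]
      gcongr
      exact hb.2
    · rw [uIoc_of_le hu'0] at ht
      have htU : t ≤ U := ht.2.trans hb.2
      have hl := hKc.dist_le_mul (t, s) ⟨⟨ht.1.le, hs.1⟩, ⟨htU, hs.2⟩⟩ (t, s')
        ⟨⟨ht.1.le, hs'.1⟩, ⟨htU, hs'.2⟩⟩
      rw [dist_eq_norm] at hl
      have hd : dist ((t, s) : ℝ × ℝ) (t, s') = |s - s'| := by
        rw [Prod.dist_eq]; simp [Real.dist_eq]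
      rw [hd] at hl
      rw [Real.norm_eq_abs, ← Γ.projT2_chart (t, s), ← Γ.projT2_chart (t, s')]
      exact (abs_sub_le_C1Norm hf _ _).trans (mul_le_mul_of_nonneg_left hl hA)
  calc _ ≤ _ := abs_sub_le _ (ergInt h f (Γ.γ s) u') _
    _ ≤ _ := add_le_add h1 h2
    _ = _ := by ring

theorem flow_sum_returnTime (hF : ReturnMapLift h Γ (F : CircleDeg1Lift)) (s : ℝ) (n : ℕ) :
    h.flow (∑ i ∈ Finset.range n, returnTime h Γ (Γ.γ ((F : CircleDeg1Lift)^[i] s : ℝ))) (Γ.γ s) =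
      Γ.γ ((F : CircleDeg1Lift)^[n] s : ℝ) := by
  induction n with
  | zero => simp [h.flow_zero]
  | succ n ih =>
    rw [Finset.sum_range_succ, add_comm, h.flow_add, ih, ← hF, Function.iterate_succ_apply']

theorem ergInt_sum_returnTime (hF : ReturnMapLift h Γ (F : CircleDeg1Lift)) {f : T2 → ℝ}
    (hf : Continuous f) (s : ℝ) (n : ℕ) :
    ergInt h f (Γ.γ s)
      (∑ i ∈ Finset.range n, returnTime h Γ (Γ.γ ((F : CircleDeg1Lift)^[i] s : ℝ))) =
      ∑ i ∈ Finset.range n, ergInt h f (Γ.γ ((F : CircleDeg1Lift)^[i] s : ℝ))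
        (returnTime h Γ (Γ.γ ((F : CircleDeg1Lift)^[i] s : ℝ))) := by
  induction n with
  | zero => simp [ergInt]
  | succ n ih =>
    rw [Finset.sum_range_succ, ergInt_add hf, ih, flow_sum_returnTime hF, Finset.sum_range_succ]

theorem exists_eq_flow_transversal (hper : h.NoPeriodicOrbits)
    (hF : ReturnMapLift h Γ (F : CircleDeg1Lift))
    (hirr : Irrational ((F : CircleDeg1Lift).translationNumber)) :
    ∃ U : ℝ, 0 ≤ U ∧ ∀ x, ∃ a s : ℝ, |a| ≤ U ∧ x = h.flow a (Γ.γ s) := by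
  obtain ⟨ε, U, hε, hU⟩ := exists_returnTime_bounds hper hF hirr
  have hU0 : 0 ≤ U := hε.le.trans ((hU 0).1.trans (hU 0).2)
  have hpos : ∀ (n : ℕ) (a s : ℝ), |a| ≤ U + n * ε →
      ∃ b r : ℝ, |b| ≤ U ∧ h.flow a (Γ.γ s) = h.flow b (Γ.γ r) := by
    intro n
    induction n with
    | zero => intro a s ha; exact ⟨a, s, by simpa using ha, rfl⟩
    | succ n ih =>
      intro a s ha
      push_cast at ha
      have hnε : 0 ≤ n * ε := by positivity
      by_cases hsmall : |a| ≤ U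
      · exact ⟨a, s, hsmall, rfl⟩
      push Not at hsmall
      obtain ⟨ha1, ha2⟩ := abs_le.1 ha
      rcases le_total 0 a with h0 | h0
      · obtain ⟨hl, hr⟩ := hU s
        rw [abs_of_nonneg h0] at hsmall
        obtain ⟨b, r, hb, hbr⟩ := ih (a - returnTime h Γ (Γ.γ s)) ((F : CircleDeg1Lift) s)
          (abs_le.2 ⟨by linarith, by linarith⟩)
        refine ⟨b, r, hb, ?_⟩
        rw [← hbr, hF s, ← h.flow_add, sub_add_cancel]
      · set s' := ((F⁻¹ : CircleDeg1Liftˣ) : CircleDeg1Lift) s with hs'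
        have hFs : (F : CircleDeg1Lift) s' = s := CircleDeg1Lift.units_apply_inv_apply F s
        obtain ⟨hl, hr⟩ := hU s'
        rw [abs_of_nonpos h0] at hsmall
        obtain ⟨b, r, hb, hbr⟩ := ih (a + returnTime h Γ (Γ.γ s')) s'
          (abs_le.2 ⟨by linarith, by linarith⟩)
        refine ⟨b, r, hb, ?_⟩
        have := hF s'
        rw [hFs] at this
        rw [← hbr, this, ← h.flow_add]
  refine ⟨U, hU0, fun x => ?_⟩
  obtain ⟨t, c, hc⟩ := Γ.meets x
  obtain ⟨s, rfl⟩ := QuotientAddGroup.mk_surjective c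
  obtain ⟨n, hn⟩ := exists_nat_ge (|t| / ε)
  rw [div_le_iff₀ hε] at hn
  obtain ⟨b, r, hb, hbr⟩ := hpos n (-t) s (by rw [abs_neg]; linarith)
  refine ⟨b, r, hb, ?_⟩
  rw [← hbr, ← h.flow_neg_flow t x, ← hc]

theorem exists_abs_ergInt_sub_le (hper : h.NoPeriodicOrbits)
    (hF : ReturnMapLift h Γ (F : CircleDeg1Lift))
    (hct : IsOfConstantType ((F : CircleDeg1Lift).translationNumber)) :
    ∃ K₁ K₂ : ℝ, ∀ f : T2 → ℝ, ContDiff ℝ 1 (fun v => f (projT2 v)) →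
      ∀ x y : T2, ∀ T : ℝ, 0 < T →
        |ergInt h f x T - ergInt h f y T| ≤ K₁ * C1Norm f * Real.log (1 + T) + K₂ * C1Norm f := by
  have hirr := hct.1
  obtain ⟨ε, U, hε, hU⟩ := exists_returnTime_bounds hper hF hirr
  obtain ⟨L, hL0, hL⟩ := exists_lipschitz_ergInt hper hF hirr
  obtain ⟨M, hM, hlog⟩ := exists_abs_birkhoffSum_sub_le hct
  obtain ⟨V, hV0, hV⟩ := exists_eq_flow_transversal hper hF hirr
  have hone : ContDiff ℝ 1 fun v => (fun _ : T2 => (1 : ℝ)) (projT2 v) := contDiff_const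
  have hbirk : ∀ f : T2 → ℝ, ContDiff ℝ 1 (fun v => f (projT2 v)) → ∀ s s' N, _ :=
    fun f hf => hlog (fun s => ergInt h f (Γ.γ s) (returnTime h Γ (Γ.γ s))) (L * C1Norm f)
      (fun s => by rw [returnTime_add_one, AddCircle.coe_add, AddCircle.coe_period, add_zero]) (mul_nonneg hL0 C1Norm_nonneg) (hL f hf)
  set c := Real.log (1 + 1 / ε) with hc
  have main : ∀ f : T2 → ℝ, ContDiff ℝ 1 (fun v => f (projT2 v)) → ∀ s s' T : ℝ, 0 < T →
      |ergInt h f (Γ.γ s) T - ergInt h f (Γ.γ s') T| ≤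
        C1Norm f * (2 * U + 18 * L * (1 + M * (Real.log (1 + T) + c))) := by
    intro f hf s s' T hT
    have hA := C1Norm_nonneg (f := f)
    have hfc := continuous_of_contDiff_projT2 hf
    set S : ℝ → ℕ → ℝ := fun s n =>
      ∑ i ∈ Finset.range n, returnTime h Γ (Γ.γ ((F : CircleDeg1Lift)^[i] s : ℝ)) with hS
    have hSε : ∀ n : ℕ, n * ε ≤ S s n := fun n => by
      have := Finset.card_nsmul_le_sum (Finset.range n)
        (fun i => returnTime h Γ (Γ.γ ((F : CircleDeg1Lift)^[i] s : ℝ))) ε (fun i _ => (hU _).1)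
      simpa using this
    obtain ⟨N, hN1, hN2⟩ : ∃ N, S s N ≤ T ∧ T < S s (N + 1) := by
      have hex : ∃ n, T < S s (n + 1) := by
        obtain ⟨n, hn⟩ := exists_nat_gt (T / ε)
        rw [div_lt_iff₀ hε] at hn
        refine ⟨n, hn.trans_le (le_trans ?_ (hSε (n + 1)))⟩
        push_cast; nlinarith
      classical
      refine ⟨Nat.find hex, ?_, Nat.find_spec hex⟩
      rcases Nat.eq_zero_or_pos (Nat.find hex) with h0 | h0
      · rw [h0]; simpa [hS] using hT.le
      · have := Nat.find_min hex (Nat.sub_lt h0 one_pos)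
        rw [Nat.sub_add_cancel (m := 1) h0] at this
        exact not_lt.1 this
    have hTU : T - S s N ≤ U := by
      have : S s (N + 1) = S s N + _ := Finset.sum_range_succ _ N
      have := (hU ((F : CircleDeg1Lift)^[N] s)).2
      linarith
    have hNlog : Real.log (1 + N) ≤ Real.log (1 + T) + c := by
      rw [hc, ← Real.log_mul (by positivity) (by positivity)]
      have : N * ε ≤ T := (hSε N).trans hN1
      have : (N : ℝ) ≤ T * (1 / ε) := by rw [mul_one_div, le_div_iff₀ hε]; exact this
      refine Real.log_le_log (by positivity) ?_
      have : 0 < 1 / ε := by positivity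
      nlinarith
    set E := 9 * L * (1 + M * (Real.log (1 + T) + c)) with hE
    have hEN : 9 * L * (1 + M * Real.log (1 + N)) ≤ E := by rw [hE]; gcongr
    have hsplit : ∀ r : ℝ, ergInt h f (Γ.γ r) T - ergInt h f (Γ.γ r) (S r N) =
        ergInt h f (h.flow (S r N) (Γ.γ r)) (T - S r N) := fun r => by
      have := ergInt_add (h := h) hfc (Γ.γ r) (S r N) (T - S r N)
      rw [add_sub_cancel] at this
      rw [this, add_sub_cancel_left]
    have b1 : |ergInt h f (Γ.γ s) T - ergInt h f (Γ.γ s) (S s N)| ≤ C1Norm f * U := by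
      rw [hsplit]
      refine (abs_ergInt_le hf _ _).trans (mul_le_mul_of_nonneg_left ?_ hA)
      rwa [abs_of_nonneg (sub_nonneg.2 hN1)]
    have b2 : |S s N - S s' N| ≤ E := by
      have := hbirk (fun _ => 1) hone s s' N
      simp only [ergInt_one, C1Norm_one, mul_one] at this
      exact this.trans hEN
    have b3 : |ergInt h f (Γ.γ s') T - ergInt h f (Γ.γ s') (S s' N)| ≤ C1Norm f * (U + E) := by
      rw [hsplit]
      refine (abs_ergInt_le hf _ _).trans (mul_le_mul_of_nonneg_left ?_ hA)
      rw [abs_le] at *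
      constructor <;> linarith [b2.1, b2.2]
    have b4 : |ergInt h f (Γ.γ s) (S s N) - ergInt h f (Γ.γ s') (S s' N)| ≤ C1Norm f * E := by
      rw [ergInt_sum_returnTime hF hfc, ergInt_sum_returnTime hF hfc]
      refine (hbirk f hf s s' N).trans ?_
      calc _ = C1Norm f * (9 * L * (1 + M * Real.log (1 + N))) := by ring
        _ ≤ _ := mul_le_mul_of_nonneg_left hEN hA
    have : C1Norm f * (2 * U + 18 * L * (1 + M * (Real.log (1 + T) + c))) =
        C1Norm f * U + C1Norm f * (U + E) + C1Norm f * E := by rw [hE]; ring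
    rw [this]
    rw [abs_le] at *
    constructor <;> linarith [b1.1, b1.2, b3.1, b3.2, b4.1, b4.2]
  refine ⟨18 * L * M, 4 * V + 2 * U + 18 * L * (1 + M * c), fun f hf x y T hT => ?_⟩
  have hA := C1Norm_nonneg (f := f)
  obtain ⟨a, s, ha, rfl⟩ := hV x
  obtain ⟨b, s', hb, rfl⟩ := hV y
  have c1 := (abs_ergInt_flow_sub_le (h := h) hf (Γ.γ s) a T).trans
    (mul_le_mul_of_nonneg_left (mul_le_mul_of_nonneg_left ha hA) zero_le_two)
  have c2 := (abs_ergInt_flow_sub_le (h := h) hf (Γ.γ s') b T).trans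
    (mul_le_mul_of_nonneg_left (mul_le_mul_of_nonneg_left hb hA) zero_le_two)
  have c3 := main f hf s s' T hT
  rw [abs_le] at *
  constructor <;> linarith [c1.1, c1.2, c2.1, c2.2, c3.1, c3.2]

theorem integral_ergInt (μ : Measure T2) [IsProbabilityMeasure μ]
    (hinv : ∀ t, MeasurePreserving (h.flow t) μ μ) {f : T2 → ℝ} (hf : Continuous f)
    {T : ℝ} (hT : 0 ≤ T) :
    Integrable (fun y => ergInt h f y T) μ ∧ ∫ y, ergInt h f y T ∂μ = T * ∫ y, f y ∂μ := by
  obtain ⟨C, hC⟩ := isCompact_univ.exists_bound_of_continuousOn hf.continuousOn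
  have hcont : Continuous (Function.uncurry fun (y : T2) (t : ℝ) => f (h.flow t y)) :=
    hf.comp (h.continuous_flow.comp continuous_swap)
  have hint : Integrable (Function.uncurry fun (y : T2) (t : ℝ) => f (h.flow t y))
      (μ.prod (volume.restrict (Ioc 0 T))) :=
    Integrable.of_bound hcont.aestronglyMeasurable C (Filter.Eventually.of_forall fun z =>
      hC _ (mem_univ _))
  have hE : (fun y => ergInt h f y T) = fun y => ∫ t in Ioc 0 T, f (h.flow t y) := by
    ext y; exact intervalIntegral.integral_of_le hT
  rw [hE]
  refine ⟨hint.integral_prod_left, ?_⟩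
  rw [integral_integral_swap hint]
  have : ∀ t, ∫ y, f (h.flow t y) ∂μ = ∫ y, f y ∂μ := fun t => by
    have h1 := integral_map (hinv t).measurable.aemeasurable
      (f := f) (hf.aestronglyMeasurable (μ := μ.map (h.flow t)))
    rw [(hinv t).map_eq] at h1
    exact h1.symm
  simp [this, hT]

end Assembly

/-- **Main theorem.** For a `C¹` flow on `𝕋²` without critical points and periodic
orbits, admitting a closed transversal whose first return map has rotation number of
constant type, ergodic integrals of zero-mean `C¹` observables grow at most
logarithmically. -/
theorem main_log_bound (h : C1FlowT2)
    (hcrit : h.NoCriticalPoints) (hper : h.NoPeriodicOrbits)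
    (Γ : ClosedTransversal h) (F : CircleDeg1Liftˣ)
    (hF : ReturnMapLift h Γ (F : CircleDeg1Lift))
    (hct : IsOfConstantType ((F : CircleDeg1Lift).translationNumber))
    (μ : Measure T2) [IsProbabilityMeasure μ]
    (hinv : ∀ t, MeasurePreserving (h.flow t) μ μ)
    (huniq : ∀ μ' : Measure T2, IsProbabilityMeasure μ' →
      (∀ t, MeasurePreserving (h.flow t) μ' μ') → μ' = μ) :
    ∃ K₁ K₂ : ℝ, ∀ f : T2 → ℝ, ContDiff ℝ 1 (fun v => f (projT2 v)) →
      ∫ y, f y ∂μ = 0 → ∀ x : T2, ∀ T : ℝ, 0 < T →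
        |ergInt h f x T| ≤ K₁ * C1Norm f * Real.log (1 + T) + K₂ * C1Norm f := by
  obtain ⟨K₁, K₂, hK⟩ := exists_abs_ergInt_sub_le hper hF hct
  refine ⟨K₁, K₂, fun f hf hf0 x T hT => ?_⟩
  obtain ⟨hint, hzero⟩ := integral_ergInt μ hinv (continuous_of_contDiff_projT2 hf) hT.le
  have hx : ∫ y, (ergInt h f x T - ergInt h f y T) ∂μ = ergInt h f x T := by
    rw [integral_sub (integrable_const _) hint, hzero, hf0]
    simp
  have hb := norm_integral_le_of_norm_le_const (μ := μ)
    (Filter.Eventually.of_forall fun y => (Real.norm_eq_abs _).trans_le (hK f hf x y T hT))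
  rw [hx] at hb
  simpa using hb
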